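/- Assume m is odd (so that M = m − 2n is odd and all Gamma values below are taken at half-odd-integer arguments, hence finite and nonzero). For 0 ≤ i ≤ ⌊k/2⌋ define the operator ℙ_i^k = ∑_{l=0}^{⌊k/2⌋−i} ((−1)^l / (4^{l+i} l! i!)) (k − 2i + M/2 − 1) (Γ(k − 2i − l − 1 + M/2) / Γ(k − i + M/2)) x^{2l} Δ^{i+l} acting on 𝒫_k. Then for all 0 ≤ i, j ≤ ⌊k/2⌋ and all H_{k−2j} ∈ ℋ_{k−2j}: ℙ_i^k(x^{2j} H_{k−2j}) = δ_{ij} H_{k−2j}. -/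

import Mathlib

set_option synthInstance.maxHeartbeats 1000000
set_option maxHeartbeats 1000000
open scoped TensorProduct
open MvPolynomial

noncomputable section

variable (m n : ℕ)

/-- The Grassmann algebra Λ_{2n} on `2n` anticommuting generators. -/
abbrev Grass (n : ℕ) := ExteriorAlgebra ℝ (Fin (2*n) → ℝ)

/-- The algebra of super-polynomials 𝒫 = ℝ[x_1,…,x_m] ⊗ Λ_{2n}. -/
abbrev SuperPoly (m n : ℕ) := MvPolynomial (Fin m) ℝ ⊗[ℝ] Grass n

/-- The fermionic generator x`_i. -/
def fgen (i : Fin (2*n)) : Grass n :=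
  ExteriorAlgebra.ι ℝ (Pi.single i (1:ℝ))

/-- The fermionic partial derivative ∂_{x`_i}, the odd derivation with
∂_{x`_i}(x`_j) = δ_{ij}: contraction with the i-th dual basis vector. -/
def fpderiv (i : Fin (2*n)) : Grass n →ₗ[ℝ] Grass n :=
  CliffordAlgebra.contractLeft (LinearMap.proj i)

/-- The fermionic Laplace operator on Λ_{2n}. -/
def lapF : Grass n →ₗ[ℝ] Grass n :=
  (4:ℝ) • ∑ j : Fin n,
    (fpderiv n ⟨2*j.1, by omega⟩) ∘ₗ (fpderiv n ⟨2*j.1+1, by omega⟩)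

/-- The bosonic Laplace operator Δ_b = −∑ ∂_{x_j}² on ℝ[x_1,…,x_m]. -/
def lapB : MvPolynomial (Fin m) ℝ →ₗ[ℝ] MvPolynomial (Fin m) ℝ :=
  - ∑ j : Fin m, (pderiv j).toLinearMap ∘ₗ (pderiv j).toLinearMap

/-- The super Laplace operator Δ = Δ_b + Δ_f on 𝒫. -/
def lap : SuperPoly m n →ₗ[ℝ] SuperPoly m n :=
  LinearMap.rTensor (Grass n) (lapB m) + LinearMap.lTensor (MvPolynomial (Fin m) ℝ) (lapF n)

/-- x̲² = −∑ x_j². -/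
def rb2 : MvPolynomial (Fin m) ℝ := - ∑ j : Fin m, (X j)^2

/-- x`² = ∑_{j=1}^n x`_{2j−1} x`_{2j}. -/
def rf2 : Grass n := ∑ j : Fin n, fgen n ⟨2*j.1, by omega⟩ * fgen n ⟨2*j.1+1, by omega⟩

/-- The generalized norm squared x² = x̲² + x`² as an element of 𝒫. -/
def r2 : SuperPoly m n := (rb2 m) ⊗ₜ 1 + 1 ⊗ₜ (rf2 n)

/-- The grade-`i` part of the Grassmann algebra. -/
def fgrade (i : ℕ) : Submodule ℝ (Grass n) :=
  (LinearMap.range (ExteriorAlgebra.ι ℝ (M := Fin (2*n) → ℝ)))^i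

/-- The space 𝒫_k of super-polynomials homogeneous of total degree k. -/
def P (k : ℕ) : Submodule ℝ (SuperPoly m n) :=
  ⨆ i : Fin (k+1), Submodule.map₂ (TensorProduct.mk ℝ _ _)
    (homogeneousSubmodule (Fin m) ℝ (k - i.1)) (fgrade n i.1)

/-- The space ℋ_k of spherical harmonics of degree k. -/
def H (k : ℕ) : Submodule ℝ (SuperPoly m n) :=
  P m n k ⊓ LinearMap.ker (lap m n)

/-- The super-dimension M = m − 2n. -/
def sdim : ℤ := (m : ℤ) - 2*n

/-- The projection operator
ℙ_i^k = ∑_{l=0}^{⌊k/2⌋−i} ((−1)^l/(4^{l+i} l! i!)) (k−2i+M/2−1)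
          (Γ(k−2i−l−1+M/2)/Γ(k−i+M/2)) x^{2l} Δ^{i+l}. -/
def fischerProj (m n k i : ℕ) : SuperPoly m n →ₗ[ℝ] SuperPoly m n :=
  ∑ l ∈ Finset.range (k/2 - i + 1),
    (((-1:ℝ)^l / (4^(l+i) * l.factorial * i.factorial)) *
      ((k:ℝ) - 2*i + ((sdim m n : ℝ))/2 - 1) *
      (Real.Gamma ((k:ℝ) - 2*i - l - 1 + ((sdim m n : ℝ))/2) /
        Real.Gamma ((k:ℝ) - i + ((sdim m n : ℝ))/2))) •
    (LinearMap.mulLeft ℝ ((r2 m n)^l) ∘ₗ ((lap m n)^(i+l)))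

theorem lapB_rb2_mul {a : ℕ} {p : MvPolynomial (Fin m) ℝ} (hp : p.IsHomogeneous a) :
    lapB m (rb2 m * p) = rb2 m * lapB m p + (4 * a + 2 * m : ℝ) • p := by
  have hX (j : Fin m) : pderiv j (∑ i : Fin m, (X i : MvPolynomial (Fin m) ℝ) ^ 2) = 2 * X j := by
    rw [map_sum, Finset.sum_eq_single j]
    · simp
    · intro i _ hij
      simp [pderiv_X_of_ne hij]
    · simp
  have h2 (j : Fin m) : pderiv j (2 : MvPolynomial (Fin m) ℝ) = 0 := by
    simpa using (pderiv j : Derivation ℝ _ _).map_natCast 2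
  have hterm (j : Fin m) :
      pderiv j (pderiv j ((∑ i : Fin m, (X i : MvPolynomial (Fin m) ℝ) ^ 2) * p)) =
        2 * p + 4 * (X j * pderiv j p) +
          (∑ i : Fin m, (X i : MvPolynomial (Fin m) ℝ) ^ 2) * pderiv j (pderiv j p) := by
    simp only [pderiv_mul, map_add, hX, h2, pderiv_X_self]
    ring
  have hE := hp.sum_X_mul_pderiv
  simp only [lapB, rb2, LinearMap.neg_apply, LinearMap.sum_apply, LinearMap.comp_apply,
    Derivation.coeFn_coe, neg_mul, map_neg, hterm,
    Finset.sum_add_distrib, ← Finset.mul_sum, hE]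
  simp only [Finset.sum_const, Finset.card_univ, Fintype.card_fin, nsmul_eq_mul, smul_eq_C_mul,
    map_add, map_mul, map_natCast, map_ofNat]
  ring

theorem fpderiv_fgen_mul (i j : Fin (2 * n)) (g : Grass n) :
    fpderiv n i (fgen n j * g) = (if i = j then g else 0) - fgen n j * fpderiv n i g := by
  have h := CliffordAlgebra.contractLeft_ι_mul
    (Q := (0 : QuadraticForm ℝ (Fin (2 * n) → ℝ)))
    (LinearMap.proj i : Module.Dual ℝ (Fin (2 * n) → ℝ)) (Pi.single j 1) g
  refine h.trans ?_
  congr 1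
  by_cases hij : i = j <;> simp [hij]

theorem fpderiv_fpderiv_fgen_mul_fgen_mul {a b c d : Fin (2 * n)} (hac : a = c ↔ b = d)
    (had : a ≠ d) (hbc : b ≠ c) (g : Grass n) :
    fpderiv n a (fpderiv n b (fgen n c * fgen n d * g)) =
      (if b = d then -g + fgen n a * fpderiv n a g + fgen n b * fpderiv n b g else 0) +
        fgen n c * fgen n d * fpderiv n a (fpderiv n b g) := by
  by_cases hbd : b = d
  · have h := hac.2 hbd
    subst hbd h
    simp only [mul_assoc, fpderiv_fgen_mul, map_sub, map_neg, hbc, had, if_true, if_false, mul_sub,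
      zero_sub, mul_neg]
    abel
  · have h : a ≠ c := fun h => hbd (hac.1 h)
    simp [mul_assoc, fpderiv_fgen_mul, hbd, h, had, hbc]

theorem sum_fin_two_mul {A : Type*} [AddCommMonoid A] (f : Fin (2 * n) → A) :
    ∑ i, f i = ∑ j : Fin n, (f ⟨2 * j.1, by omega⟩ + f ⟨2 * j.1 + 1, by omega⟩) := by
  let g : ℕ → A := fun i => if h : i < 2 * n then f ⟨i, h⟩ else 0
  have hg (N : ℕ) : ∑ i ∈ Finset.range (2 * N), g i =
      ∑ j ∈ Finset.range N, (g (2 * j) + g (2 * j + 1)) := by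
    induction N with
    | zero => simp
    | succ N ih =>
      rw [show 2 * (N + 1) = 2 * N + 1 + 1 by ring, Finset.sum_range_succ, Finset.sum_range_succ,
        ih, Finset.sum_range_succ, add_assoc]
  have h := hg n
  rw [Finset.sum_range, Finset.sum_range] at h
  convert h using 2 with i _ j _
  · simp [g]
  · have h1 : 2 * j.1 < 2 * n := by omega
    have h2 : 2 * j.1 + 1 < 2 * n := by omega
    simp [g, h1, h2]

theorem ι_eq_sum_fgen (v : Fin (2 * n) → ℝ) :
    ExteriorAlgebra.ι ℝ v = ∑ i, v i • fgen n i := by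
  simp only [fgen, ← map_smul, ← map_sum]
  congr 1
  ext j
  simp [Finset.sum_apply, Pi.single_apply]

/-- Euler's identity for the Grassmann algebra. -/
theorem sum_fgen_mul_fpderiv {b : ℕ} {g : Grass n} (hg : g ∈ fgrade n b) :
    ∑ i, fgen n i * fpderiv n i g = (b : ℝ) • g := by
  induction hg using Submodule.pow_induction_on_left' with
  | algebraMap r =>
    have (i : Fin (2 * n)) : fpderiv n i (algebraMap ℝ (Grass n) r) = 0 :=
      CliffordAlgebra.contractLeft_algebraMap (Q := (0 : QuadraticForm ℝ (Fin (2 * n) → ℝ))) _ r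
    simp [this]
  | add x y i hx hy ihx ihy =>
    simp only [map_add, mul_add, Finset.sum_add_distrib, ihx, ihy, smul_add]
  | mem_mul v hv i x hx ih =>
    obtain ⟨v, rfl⟩ := hv
    have h (i : Fin (2 * n)) : fgen n i * fpderiv n i (ExteriorAlgebra.ι ℝ v * x) =
        v i • fgen n i * x + ExteriorAlgebra.ι ℝ v * (fgen n i * fpderiv n i x) := by
      have h1 : fpderiv n i (ExteriorAlgebra.ι ℝ v * x) =
          v i • x - ExteriorAlgebra.ι ℝ v * fpderiv n i x :=
        CliffordAlgebra.contractLeft_ι_mul (Q := (0 : QuadraticForm ℝ (Fin (2 * n) → ℝ))) _ v x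
      have h2 : fgen n i * ExteriorAlgebra.ι ℝ v = - (ExteriorAlgebra.ι ℝ v * fgen n i) :=
        eq_neg_of_add_eq_zero_left (ExteriorAlgebra.ι_add_mul_swap _ _)
      rw [h1, mul_sub, ← mul_assoc, h2, neg_mul, sub_neg_eq_add, mul_assoc, mul_smul_comm,
        smul_mul_assoc]
    simp only [h, Finset.sum_add_distrib, ← Finset.mul_sum, ih, ← Finset.sum_mul, ← ι_eq_sum_fgen]
    rw [mul_smul_comm, Nat.succ_eq_add_one, Nat.cast_add, Nat.cast_one, add_smul, one_smul, add_comm]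

theorem lapF_rf2_mul {b : ℕ} {g : Grass n} (hg : g ∈ fgrade n b) :
    lapF n (rf2 n * g) = rf2 n * lapF n g + (4 * b - 4 * n : ℝ) • g := by
  have hterm (i : Fin n) : fpderiv n ⟨2 * i.1, by omega⟩
      (fpderiv n ⟨2 * i.1 + 1, by omega⟩ (rf2 n * g)) =
      rf2 n * fpderiv n ⟨2 * i.1, by omega⟩ (fpderiv n ⟨2 * i.1 + 1, by omega⟩ g) +
      (-g + (fgen n ⟨2 * i.1, by omega⟩ * fpderiv n ⟨2 * i.1, by omega⟩ g +
        fgen n ⟨2 * i.1 + 1, by omega⟩ * fpderiv n ⟨2 * i.1 + 1, by omega⟩ g)) := by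
    have h (j : Fin n) := fpderiv_fpderiv_fgen_mul_fgen_mul n
      (a := ⟨2 * i.1, by omega⟩) (b := ⟨2 * i.1 + 1, by omega⟩)
      (c := ⟨2 * j.1, by omega⟩) (d := ⟨2 * j.1 + 1, by omega⟩)
      (by simp) (by simp; omega) (by simp; omega) g
    simp only [rf2, Finset.sum_mul, map_sum, h, Finset.sum_add_distrib]
    rw [Finset.sum_eq_single i]
    · simp only [if_true]
      abel
    · intro j _ hji
      rw [if_neg]
      simpa [Fin.ext_iff, eq_comm] using hji
    · simp
  have hE := sum_fgen_mul_fpderiv n hg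
  rw [sum_fin_two_mul] at hE
  simp only [lapF, LinearMap.smul_apply, LinearMap.sum_apply, LinearMap.comp_apply, hterm]
  rw [Finset.sum_add_distrib, Finset.sum_add_distrib, hE, ← Finset.mul_sum]
  simp only [Finset.sum_const, Finset.card_univ, Fintype.card_fin, mul_smul_comm]
  rw [← Nat.cast_smul_eq_nsmul ℝ]
  module

theorem tmul_mem_P {a b : ℕ} {p : MvPolynomial (Fin m) ℝ} (hp : p.IsHomogeneous a)
    {g : Grass n} (hg : g ∈ fgrade n b) : p ⊗ₜ[ℝ] g ∈ P m n (a + b) := by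
  refine Submodule.mem_iSup_of_mem (⟨b, by omega⟩ : Fin (a + b + 1)) ?_
  refine Submodule.apply_mem_map₂ _ ?_ hg
  rw [mem_homogeneousSubmodule]
  simpa using hp

theorem P_le {d : ℕ} {S : Submodule ℝ (SuperPoly m n)}
    (h : ∀ a b p g, a + b = d → IsHomogeneous p a → g ∈ fgrade n b → p ⊗ₜ[ℝ] g ∈ S) :
    P m n d ≤ S :=
  iSup_le fun i => Submodule.map₂_le.2 fun p hp g hg =>
    h (d - i.1) i.1 p g (Nat.sub_add_cancel (Nat.lt_succ_iff.1 i.2)) hp hg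

theorem rb2_isHomogeneous : (rb2 m).IsHomogeneous 2 :=
  (IsHomogeneous.sum _ _ _ fun j _ => (isHomogeneous_X ℝ j).pow 2).neg

theorem rf2_mem_fgrade : rf2 n ∈ fgrade n 2 := by
  refine Submodule.sum_mem _ fun j _ => ?_
  rw [fgrade, pow_two]
  exact Submodule.mul_mem_mul ⟨_, rfl⟩ ⟨_, rfl⟩

theorem r2_mul_tmul (p : MvPolynomial (Fin m) ℝ) (g : Grass n) :
    r2 m n * (p ⊗ₜ[ℝ] g) = (rb2 m * p) ⊗ₜ[ℝ] g + p ⊗ₜ[ℝ] (rf2 n * g) := by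
  simp [r2, add_mul]

theorem r2_mul_mem_P {d : ℕ} {f : SuperPoly m n} (hf : f ∈ P m n d) :
    r2 m n * f ∈ P m n (d + 2) := by
  have h : P m n d ≤ (P m n (d + 2)).comap (LinearMap.mulLeft ℝ (r2 m n)) := by
    refine P_le m n ?_
    rintro a b p g rfl hp hg
    rw [Submodule.mem_comap, LinearMap.mulLeft_apply, r2_mul_tmul]
    refine add_mem ?_ ?_
    · convert tmul_mem_P m n ((rb2_isHomogeneous m).mul hp) hg using 2
      ring
    · have : rf2 n * g ∈ fgrade n (2 + b) := by
        rw [fgrade, pow_add]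
        exact Submodule.mul_mem_mul (rf2_mem_fgrade n) hg
      convert tmul_mem_P m n hp this using 2
      ring
  exact h hf

theorem r2_pow_mul_mem_P {d : ℕ} {f : SuperPoly m n} (hf : f ∈ P m n d) (s : ℕ) :
    r2 m n ^ s * f ∈ P m n (d + 2 * s) := by
  induction s with
  | zero => simpa using hf
  | succ s ih =>
    rw [pow_succ', mul_assoc]
    exact r2_mul_mem_P m n ih

/-- The commutation relation `[Δ, x²] = 4 𝔼 + 2 M` on homogeneous super-polynomials. -/
theorem lap_r2_mul {d : ℕ} {f : SuperPoly m n} (hf : f ∈ P m n d) :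
    lap m n (r2 m n * f) = r2 m n * lap m n f + (4 * d + 2 * (sdim m n : ℝ)) • f := by
  have h : P m n d ≤ LinearMap.eqLocus (lap m n ∘ₗ LinearMap.mulLeft ℝ (r2 m n))
      (LinearMap.mulLeft ℝ (r2 m n) ∘ₗ lap m n +
        (4 * d + 2 * (sdim m n : ℝ)) • LinearMap.id) := by
    refine P_le m n ?_
    rintro a b p g rfl hp hg
    simp only [LinearMap.mem_eqLocus, LinearMap.comp_apply, LinearMap.mulLeft_apply,
      LinearMap.smul_apply, LinearMap.id_apply, lap, r2_mul_tmul, LinearMap.add_apply, map_add,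
      LinearMap.rTensor_tmul, LinearMap.lTensor_tmul, lapB_rb2_mul m hp, lapF_rf2_mul n hg,
      TensorProduct.add_tmul, TensorProduct.tmul_add, ← TensorProduct.smul_tmul',
      TensorProduct.tmul_smul, sdim]
    push_cast
    module
  exact h hf

theorem lap_r2_pow_succ_mul {d : ℕ} {f : SuperPoly m n} (hf : f ∈ H m n d) (s : ℕ) :
    lap m n (r2 m n ^ (s + 1) * f) =
      (4 * (s + 1) * (d + s + (sdim m n : ℝ) / 2)) • (r2 m n ^ s * f) := by
  have hΔ : lap m n f = 0 := hf.2
  induction s with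
  | zero =>
    have h := lap_r2_mul m n hf.1
    rw [hΔ, mul_zero, zero_add] at h
    simp only [zero_add, pow_one, pow_zero, one_mul, h]
    congr 1
    push_cast
    ring
  | succ s ih =>
    rw [pow_succ', mul_assoc, lap_r2_mul m n (r2_pow_mul_mem_P m n hf.1 (s + 1)), ih,
      mul_smul_comm, ← mul_assoc, ← pow_succ', ← add_smul]
    congr 1
    push_cast
    ring

theorem Real.Gamma_add_one_of_ne_int {x : ℝ} (hx : ∀ q : ℤ, x ≠ q) (q : ℤ) :
    Real.Gamma (x + q + 1) = (x + q) * Real.Gamma (x + q) := by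
  refine Real.Gamma_add_one fun h => hx (-q) ?_
  push_cast
  linarith

theorem Real.Gamma_ne_zero_of_ne_int {x : ℝ} (hx : ∀ q : ℤ, x ≠ q) (q : ℤ) :
    Real.Gamma (x + q) ≠ 0 := by
  refine Real.Gamma_ne_zero fun N h => hx (-q - N) ?_
  push_cast
  linarith

theorem lap_pow_r2_pow_mul (hM : ∀ q : ℤ, (sdim m n : ℝ) / 2 ≠ q) {d : ℕ} {f : SuperPoly m n}
    (hf : f ∈ H m n d) (s t : ℕ) :
    (lap m n ^ t) (r2 m n ^ (s + t) * f) =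
      (4 ^ t * ((s + t).factorial / s.factorial : ℝ) *
        (Real.Gamma ((sdim m n : ℝ) / 2 + (d + s + t : ℤ)) /
          Real.Gamma ((sdim m n : ℝ) / 2 + (d + s : ℤ)))) • (r2 m n ^ s * f) := by
  have hΓ := Real.Gamma_ne_zero_of_ne_int hM
  have hs : (s.factorial : ℝ) ≠ 0 := by positivity
  induction t with
  | zero =>
    have := hΓ (d + s)
    simp_all
  | succ t ih =>
    have h1 := Real.Gamma_add_one_of_ne_int hM (d + s + t)
    rw [pow_succ, Module.End.mul_apply, ← add_assoc, lap_r2_pow_succ_mul m n hf, map_smul, ih,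
      smul_smul]
    congr 1
    rw [show (sdim m n : ℝ) / 2 + ((d + s + (t + 1 : ℕ) : ℤ) : ℝ) =
      (sdim m n : ℝ) / 2 + ((d + s + t : ℤ) : ℝ) + 1 by push_cast; ring, h1, Nat.factorial_succ]
    push_cast
    ring

theorem lap_pow_r2_pow_mul_of_lt {d : ℕ} {f : SuperPoly m n} (hf : f ∈ H m n d) {s t : ℕ}
    (hst : s < t) : (lap m n ^ t) (r2 m n ^ s * f) = 0 := by
  have hΔ : lap m n f = 0 := hf.2
  induction t generalizing s with
  | zero => omega
  | succ t ih =>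
    rw [pow_succ, Module.End.mul_apply]
    cases s with
    | zero => simp [hΔ]
    | succ s => rw [lap_r2_pow_succ_mul m n hf, map_smul, ih (by omega), smul_zero]

theorem Polynomial.sum_neg_one_pow_div_factorial_mul_eval {p : Polynomial ℝ} {N : ℕ}
    (hp : p.natDegree < N) :
    ∑ l ∈ Finset.range (N + 1),
      (-1 : ℝ) ^ l / (l.factorial * (N - l).factorial) * p.eval (l : ℝ) = 0 := by
  have h := congrFun (Polynomial.fwdDiff_iter_eq_zero_of_degree_lt hp) 0
  rw [fwdDiff_iter_eq_sum_shift] at h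
  have h' : (-1 : ℝ) ^ N / N.factorial * ∑ l ∈ Finset.range (N + 1),
      ((-1 : ℤ) ^ (N - l) * N.choose l) • p.eval (0 + l • (1 : ℝ)) = 0 := by
    rw [h]; simp
  rw [← h', Finset.mul_sum]
  refine Finset.sum_congr rfl fun l hl => ?_
  have hl : l ≤ N := by simpa [Nat.lt_succ_iff] using hl
  have hN : (N.factorial : ℝ) ≠ 0 := by positivity
  have hsign : (-1 : ℝ) ^ N * (-1) ^ (N - l) = (-1) ^ l := by
    rw [← pow_add, show N + (N - l) = l + 2 * (N - l) by omega, pow_add, pow_mul]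
    simp
  rw [zsmul_eq_mul]
  push_cast
  rw [Nat.cast_choose ℝ hl, ← hsign, zero_add, nsmul_one]
  field_simp

theorem Real.Gamma_add_nat_eq_ascPochhammer_mul {x : ℝ} (hx : ∀ q : ℤ, x ≠ q) (q : ℕ) :
    Real.Gamma (x + q) = (ascPochhammer ℝ q).eval x * Real.Gamma x := by
  induction q with
  | zero => simp
  | succ q ih =>
    have h := Real.Gamma_add_one_of_ne_int hx q
    push_cast at h ⊢
    rw [← add_assoc, h, ih, ascPochhammer_succ_eval]
    ring

theorem sum_neg_one_pow_mul_Gamma_div_Gamma {a : ℝ} (ha : ∀ q : ℤ, a ≠ q) (N : ℕ) :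
    ∑ l ∈ Finset.range (N + 2), (-1 : ℝ) ^ l / (l.factorial * (N + 1 - l).factorial) *
      (Real.Gamma (a - l) / Real.Gamma (a - N - l)) = 0 := by
  have hdeg : ((ascPochhammer ℝ N).comp (Polynomial.C (a - N) - Polynomial.X)).natDegree
      < N + 1 := by
    refine Nat.lt_succ_of_le (Polynomial.natDegree_comp_le.trans ?_)
    have h : (Polynomial.C (a - N) - Polynomial.X).natDegree ≤ 1 := by compute_degree
    rw [ascPochhammer_natDegree]
    nlinarith
  rw [← Polynomial.sum_neg_one_pow_div_factorial_mul_eval hdeg]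
  refine Finset.sum_congr rfl fun l _ => ?_
  congr 1
  have hne (q : ℤ) : a - N - l ≠ q := fun h => ha (q + N + l) (by push_cast; linarith)
  have hΓ : Real.Gamma (a - N - l) ≠ 0 := by simpa using Real.Gamma_ne_zero_of_ne_int hne 0
  rw [show a - l = a - N - l + N by ring, Real.Gamma_add_nat_eq_ascPochhammer_mul hne,
    mul_div_cancel_right₀ _ hΓ]
  simp

theorem sdim_div_two_ne_int (hodd : Odd m) (q : ℤ) : (sdim m n : ℝ) / 2 ≠ q := by
  intro h
  obtain ⟨r, rfl⟩ := hodd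
  have h2 : (sdim (2 * r + 1) n : ℝ) = ((2 * q : ℤ) : ℝ) := by push_cast; linarith
  have h3 := Int.cast_injective h2
  simp only [sdim] at h3
  push_cast at h3
  omega

/-- for m odd and 0 ≤ i, j ≤ ⌊k/2⌋, and H_{k−2j} ∈ ℋ_{k−2j}:
ℙ_i^k(x^{2j} H_{k−2j}) = δ_{ij} H_{k−2j}. -/
theorem fischerProj_apply (m n : ℕ) (hm : 1 ≤ m) (hn : 1 ≤ n) (hodd : Odd m)
    (k i j : ℕ) (hi : i ≤ k/2) (hj : j ≤ k/2)
    (Hkj : SuperPoly m n) (hH : Hkj ∈ H m n (k - 2*j)) :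
    fischerProj m n k i ((r2 m n)^j * Hkj) = if i = j then Hkj else 0 := by
  have hM := sdim_div_two_ne_int m n hodd
  have hΓ := Real.Gamma_ne_zero_of_ne_int hM
  simp only [fischerProj, LinearMap.sum_apply, LinearMap.smul_apply, LinearMap.comp_apply,
    LinearMap.mulLeft_apply]
  rcases lt_or_ge j i with hji | hij
  · rw [if_neg (by omega)]
    refine Finset.sum_eq_zero fun l _ => ?_
    rw [lap_pow_r2_pow_mul_of_lt m n hH (by omega), mul_zero, smul_zero]
  obtain ⟨N, rfl⟩ := Nat.exists_eq_add_of_le hij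
  obtain ⟨d, rfl⟩ : ∃ d, k = d + 2 * (i + N) := ⟨k - 2 * (i + N), by omega⟩
  rw [Nat.add_sub_cancel] at hH
  set c : ℝ := (sdim m n : ℝ) / 2
  rw [← Finset.sum_subset (s₁ := Finset.range (N + 1))
    (Finset.range_subset_range.2 (by omega)) fun l _ hl => ?_]
  swap
  · rw [Finset.mem_range] at hl
    rw [lap_pow_r2_pow_mul_of_lt m n hH (by omega), mul_zero, smul_zero]
  have hterm : ∀ l ∈ Finset.range (N + 1),
      (r2 m n) ^ l * (lap m n ^ (i + l)) (r2 m n ^ (i + N) * Hkj) =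
        (4 ^ (i + l) * ((i + N).factorial / (N - l).factorial : ℝ) *
          (Real.Gamma (c + (d + i + N : ℤ)) / Real.Gamma (c + (d + N - l : ℤ)))) •
          (r2 m n ^ N * Hkj) := by
    intro l hl
    obtain ⟨s, rfl⟩ := Nat.exists_eq_add_of_le (Nat.lt_succ_iff.1 (Finset.mem_range.1 hl))
    have h := lap_pow_r2_pow_mul m n hM hH s (i + l)
    rw [show s + (i + l) = i + (l + s) by ring] at h
    rw [h, mul_smul_comm, ← mul_assoc, ← pow_add, Nat.add_sub_cancel_left]
    congr 5 <;> push_cast <;> ring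
  rw [Finset.sum_congr rfl fun l hl => by rw [hterm l hl, smul_smul], ← Finset.sum_smul]
  cases N with
  | zero =>
    have h0 := hΓ (d + i)
    have h1 := Real.Gamma_add_one_of_ne_int hM (d - 1)
    have h2 := hΓ d
    push_cast at h0 h1 h2
    rw [show c + (d - 1) + 1 = c + d by ring] at h1
    have hi : (i.factorial : ℝ) ≠ 0 := by positivity
    simp only [zero_add, Finset.sum_range_one, pow_zero, one_mul, add_zero, if_true,
      Nat.factorial_zero, Nat.sub_zero]
    convert one_smul ℝ Hkj
    push_cast
    rw [show (d : ℝ) + 2 * i - 2 * i - 0 - 1 + c = c + (d - 1) by ring,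
      show (d : ℝ) + 2 * i - i + c = c + (d + i) by ring,
      show (d : ℝ) + 2 * i - 2 * i + c - 1 = c + (d - 1) by ring]
    simp only [add_zero, sub_zero]
    rw [h1] at h2 ⊢
    have h3 := left_ne_zero_of_mul h2
    have h4 := right_ne_zero_of_mul h2
    field_simp
  | succ N =>
    rw [if_neg (by omega)]
    convert zero_smul ℝ _
    set a : ℝ := c + (d + 2 * N + 1 : ℤ) with ha
    have hne (q : ℤ) : a ≠ q := fun h => hM (q - (d + 2 * N + 1)) (by
      rw [ha] at h
      push_cast at h ⊢
      linarith)
    have hsum := sum_neg_one_pow_mul_Gamma_div_Gamma hne N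
    rw [← mul_zero (((i + (N + 1)).factorial : ℝ) / i.factorial * a *
      (Real.Gamma (c + (d + i + (N + 1 : ℕ) : ℤ)) /
        Real.Gamma (c + (d + i + 2 * (N + 1) : ℤ)))), ← hsum, Finset.mul_sum]
    refine Finset.sum_congr rfl fun l _ => ?_
    push_cast [ha]
    rw [show (d : ℝ) + 2 * (i + (N + 1)) - 2 * i - l - 1 + c = c + (d + 2 * N + 1) - l by ring,
      show (d : ℝ) + 2 * (i + (N + 1)) - i + c = c + (d + i + 2 * (N + 1)) by ring,
      show (d : ℝ) + 2 * (i + (N + 1)) - 2 * i + c - 1 = c + (d + 2 * N + 1) by ring,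
      show c + (d + 2 * N + 1 : ℝ) - N - l = c + (d + (N + 1) - l) by ring, add_comm i l]
    field_simp

end
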